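/- For every A ∈ yℌ, B ∈ ℌx and every integer s ≥ 0, one has Z(A (x+y)^s B) = Z(τ(B) (x+y)^s τ(A)); equivalently f(A,B) = f(τ(B), τ(A)). -/

import Mathlib

open scoped BigOperators

noncomputable section

/-- `ℌ = ℚ⟨x,y⟩`, the free noncommutative polynomial ring in two indeterminates,
realized as the free `ℚ`-algebra on `Bool` (`false ↦ x`, `true ↦ y`). -/
abbrev H : Type := FreeAlgebra ℚ Bool

/-- The indeterminate `x`. -/
def Hx : H := FreeAlgebra.ι ℚ false

/-- The indeterminate `y`. -/
def Hy : H := FreeAlgebra.ι ℚ true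

/-- The multiple zeta value `ζ(k₁,…,k_r) = ∑_{0<n₁<⋯<n_r} 1/(n₁^{k₁}⋯n_r^{k_r})`. -/
def MZV (r : ℕ) (k : Fin r → ℕ) : ℝ :=
  ∑' n : {n : Fin r → ℕ // (∀ i, 0 < n i) ∧ StrictMono n},
    ∏ i, (1 : ℝ) / (n.1 i : ℝ) ^ (k i)

/-- `Z : yℌx → ℝ` is the `ℚ`-linear map with `Z(y x^{k₁-1} ⋯ y x^{k_r-1}) = ζ(k₁,…,k_r)`.
We encode it as a `ℚ`-linear map on all of `ℌ` whose values on the basis monomials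
`y x^{k₁-1} ⋯ y x^{k_r-1}` (with `k_r ≥ 2`) of `yℌx` are the multiple zeta values;
these values determine `Z` uniquely on the subspace `yℌx`. -/
def IsZetaMap (Z : H →ₗ[ℚ] ℝ) : Prop :=
  ∀ (r : ℕ) (k : Fin (r + 1) → ℕ), (∀ i, 1 ≤ k i) → 2 ≤ k (Fin.last r) →
    Z ((List.ofFn fun i => Hy * Hx ^ (k i - 1)).prod) = MZV (r + 1) k

/-- The family `f(A,B) = (Z(A(x+y)^s B))_{s ≥ 0}`. -/
def fam (Z : H →ₗ[ℚ] ℝ) (A B : H) : ℕ → ℝ := fun s => Z (A * (Hx + Hy) ^ s * B)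

/-- The `ℚ`-bilinear product `◇` on `ℌ`, characterized by its recursive defining
properties (which determine it uniquely). -/
def IsDiamond (d : H →ₗ[ℚ] H →ₗ[ℚ] H) : Prop :=
  (∀ w, d w 1 = w) ∧ (∀ w, d 1 w = w) ∧
  (∀ w1 w2, d (Hx * w1) (Hx * w2) = Hx * d w1 (Hx * w2) - Hx * d (Hy * w1) w2) ∧
  (∀ w1 w2, d (Hx * w1) (Hy * w2) = Hx * d w1 (Hy * w2) + Hy * d (Hx * w1) w2) ∧
  (∀ w1 w2, d (Hy * w1) (Hx * w2) = Hy * d w1 (Hx * w2) + Hx * d (Hy * w1) w2) ∧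
  (∀ w1 w2, d (Hy * w1) (Hy * w2) = Hy * d w1 (Hy * w2) - Hy * d (Hx * w1) w2)

/-- The harmonic product `∗` on `ℌ`, characterized by its recursive defining
properties (which determine it uniquely). -/
def IsHarmonic (st : H →ₗ[ℚ] H →ₗ[ℚ] H) : Prop :=
  (∀ w, st w 1 = w) ∧ (∀ w, st 1 w = w) ∧
  (∀ w1 w2, st (Hx * w1) w2 = Hx * st w1 w2) ∧
  (∀ w1 w2, st w1 (Hx * w2) = Hx * st w1 w2) ∧
  (∀ w1 w2, st (Hy * w1) (Hy * w2) = Hy * (st w1 (Hy * w2) + st (Hy * w1) w2 + Hx * st w1 w2))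

/-- The anti-automorphism `τ` of `ℌ` interchanging `x` and `y`, characterized by
being `ℚ`-linear, anti-multiplicative, unital, and swapping the generators. -/
def IsTau (t : H →ₗ[ℚ] H) : Prop :=
  t 1 = 1 ∧ (∀ a b, t (a * b) = t b * t a) ∧ t Hx = Hy ∧ t Hy = Hx

/-- The automorphism `φ` of `ℌ` with `φ(x) = x + y` and `φ(y) = -y`. -/
def phi : H →ₐ[ℚ] H := FreeAlgebra.lift ℚ (fun b => if b then -Hy else Hx + Hy)

/-- The automorphism `S₁` of `ℌ` with `S₁(x) = x` and `S₁(y) = x + y`. -/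
def S1 : H →ₐ[ℚ] H := FreeAlgebra.lift ℚ (fun b => if b then Hx + Hy else Hx)

/-- The Dirichlet series `∑_{n ≥ 1} a_n / n^s` (with `a n` the coefficient indexed by
`n + 1`) converges to `L` at `s`, i.e. its partial sums tend to `L`. -/
def DSConv (a : ℕ → ℝ) (s : ℕ) (L : ℝ) : Prop :=
  Filter.Tendsto (fun N => ∑ n ∈ Finset.range N, a n / ((n : ℝ) + 1) ^ s)
    Filter.atTop (nhds L)



/-! ### Connected sums (Seki–Yamamoto), in `ℝ≥0∞` -/

def dI (m : ℕ) : ENNReal := ENNReal.ofReal (1 / (m : ℝ))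
def dL (a m : ℕ) : ENNReal := if a < m then 1 else 0
def dc (m n : ℕ) : ℝ := 1 / ((m + n).choose m : ℝ)
def dC (m n : ℕ) : ENNReal := ENNReal.ofReal (dc m n)

/-- truncated sums, on reversed words -/
def dF : List Bool → ℕ → ENNReal
  | [], m => if m = 0 then 1 else 0
  | true :: w, m => ∑' a, dI m * dL a m * dF w a
  | false :: w, m => dI m * dF w m

def dK (u v : List Bool) : ENNReal := ∑' m, ∑' n, dF u m * dC m n * dF v n

lemma dI_zero : dI 0 = 0 := by simp [dI]

lemma dF_zero (u : List Bool) (hu : u ≠ []) : dF u 0 = 0 := by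
  cases u with
  | nil => exact absurd rfl hu
  | cons c u => cases c <;> simp [dF, dI_zero]

lemma dc_symm (m n : ℕ) : dc m n = dc n m := by
  unfold dc
  rw [Nat.add_comm n m, Nat.choose_symm_add]

lemma dC_symm (m n : ℕ) : dC m n = dC n m := by unfold dC; rw [dc_symm]

lemma dc_rec (m n : ℕ) (hm : 0 < m) :
    1 / ((n + 1 : ℕ) : ℝ) * dc m (n + 1) = 1 / (m : ℝ) * (dc m n - dc m (n + 1)) := by
  have h := Nat.add_one_mul_choose_eq (m + n) n
  have e1 : ((m + n).choose m : ℝ) = ((m + n).choose n : ℝ) := by rw [Nat.choose_symm_add]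
  have e2 : ((m + (n + 1)).choose m : ℝ) = ((m + n + 1).choose (n + 1) : ℝ) := by
    rw [Nat.choose_symm_add]; rfl
  have h' : ((m : ℝ) + n + 1) * ((m + n).choose n : ℝ)
      = ((m + n + 1).choose (n + 1) : ℝ) * (n + 1) := by exact_mod_cast h
  have p1 : (0 : ℝ) < ((m + n).choose n : ℝ) := by
    exact_mod_cast Nat.choose_pos (by omega)
  have p2 : (0 : ℝ) < ((m + n + 1).choose (n + 1) : ℝ) := by
    exact_mod_cast Nat.choose_pos (by omega)
  have hm' : (0 : ℝ) < m := by exact_mod_cast hm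
  unfold dc
  rw [e1, e2]
  push_cast
  field_simp
  linear_combination h'

lemma dc_tendsto (m : ℕ) (hm : 0 < m) :
    Filter.Tendsto (fun n => dc m n) Filter.atTop (nhds 0) := by
  refine squeeze_zero (fun n => ?_) (fun n => ?_) tendsto_one_div_add_atTop_nhds_zero_nat
  · unfold dc; positivity
  · unfold dc
    rw [Nat.choose_symm_add]
    have : n + 1 ≤ (m + n).choose n := by
      calc n + 1 = (n + 1).choose n := by simp
        _ ≤ _ := Nat.choose_le_choose n (by omega)
    have h2 : (n : ℝ) + 1 ≤ ((m + n).choose n : ℝ) := by exact_mod_cast this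
    exact one_div_le_one_div_of_le (by positivity) h2

lemma dc_antitone (m n J : ℕ) : dc m (n + J) ≤ dc m n := by
  unfold dc
  have : (m + n).choose m ≤ (m + (n + J)).choose m := Nat.choose_le_choose m (by omega)
  have p : 0 < (m + n).choose m := Nat.choose_pos (by omega)
  exact one_div_le_one_div_of_le (by exact_mod_cast p) (by exact_mod_cast this)

lemma dI_tsum (m n : ℕ) (hm : 0 < m) :
    ∑' b, dI b * dL n b * dC m b = dI m * dC m n := by
  have key : ∀ J, ∑ b ∈ Finset.range (J + (n + 1)), dI b * dL n b * dC m b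
      = ENNReal.ofReal (1 / (m : ℝ) * (dc m n - dc m (n + J))) := by
    intro J
    induction J with
    | zero =>
      simp only [add_zero, sub_self, mul_zero, ENNReal.ofReal_zero]
      apply Finset.sum_eq_zero
      intro b hb
      have : ¬ n < b := by simp at hb; omega
      simp [dL, this]
    | succ J ih =>
      rw [show J + 1 + (n + 1) = (J + (n + 1)) + 1 by ring, Finset.sum_range_succ, ih]
      have hl : n < J + (n + 1) := by omega
      simp only [dL, hl, if_true, mul_one, dI, dC]
      rw [← ENNReal.ofReal_mul (by positivity), ← ENNReal.ofReal_add]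
      · congr 1
        have := dc_rec m (n + J) hm
        rw [show J + (n + 1) = n + J + 1 by ring, show n + (J + 1) = n + J + 1 by ring, this]
        ring
      · have := dc_antitone m n J
        exact mul_nonneg (by positivity) (by linarith)
      · unfold dc; positivity
  have t1 := (Filter.tendsto_add_atTop_iff_nat (n + 1)).2
    (ENNReal.tendsto_nat_tsum (fun b => dI b * dL n b * dC m b))
  simp only [key] at t1
  have t2 : Filter.Tendsto (fun J => ENNReal.ofReal (1 / (m : ℝ) * (dc m n - dc m (n + J))))
      Filter.atTop (nhds (ENNReal.ofReal (1 / (m : ℝ) * (dc m n - 0)))) := by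
    apply ENNReal.tendsto_ofReal
    apply Filter.Tendsto.const_mul
    apply Filter.Tendsto.const_sub
    have := (Filter.tendsto_add_atTop_iff_nat n).2 (dc_tendsto m hm)
    simpa [add_comm] using this
  rw [tendsto_nhds_unique t1 t2, sub_zero, ENNReal.ofReal_mul (by positivity)]
  rfl

lemma dK_symm (u v : List Bool) : dK u v = dK v u := by
  unfold dK
  rw [ENNReal.tsum_comm]
  refine tsum_congr fun m => tsum_congr fun n => ?_
  rw [dC_symm]; ring

lemma dK_x (u v : List Bool) (hu : u ≠ []) : dK (false :: u) v = dK u (true :: v) := by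
  unfold dK
  refine tsum_congr fun m => ?_
  rcases Nat.eq_zero_or_pos m with rfl | hm
  · simp [dF_zero u hu, dF, dI_zero]
  calc ∑' n, dF (false :: u) m * dC m n * dF v n
      = ∑' n, ∑' b, dF u m * dF v n * (dI b * dL n b * dC m b) := by
        refine tsum_congr fun n => ?_
        rw [ENNReal.tsum_mul_left, dI_tsum m n hm]
        simp only [dF]; ring
    _ = ∑' b, ∑' n, dF u m * dF v n * (dI b * dL n b * dC m b) := ENNReal.tsum_comm
    _ = _ := by
        refine tsum_congr fun b => ?_
        simp only [dF]
        rw [← ENNReal.tsum_mul_left]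
        refine tsum_congr fun n => ?_
        ring

lemma dK_y (u v : List Bool) (hv : v ≠ []) : dK (true :: u) v = dK u (false :: v) := by
  rw [dK_symm, ← dK_x v u hv, dK_symm]

lemma dK_nil (u : List Bool) : dK u [] = ∑' m, dF u m := by
  unfold dK
  refine tsum_congr fun m => ?_
  rw [tsum_eq_single 0]
  · simp [dF, dC, dc]
  · intro n hn; simp [dF, hn]

lemma dK_move (u : List Bool) : ∀ v : List Bool, v ≠ [] →
    dK (u ++ [true]) v = dK [] (((u ++ [true]).map not).reverse ++ v) := by
  induction u with
  | nil => intro v hv; simpa using dK_y [] v hv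
  | cons c u ih =>
    intro v hv
    cases c with
    | false =>
      rw [List.cons_append, dK_x _ _ (by simp), ih _ (by simp)]
      simp
    | true =>
      rw [List.cons_append, dK_y _ _ hv, ih _ (by simp)]
      simp

lemma dF_duality (u : List Bool) :
    ∑' m, dF (false :: (u ++ [true])) m
      = ∑' m, dF ((false :: (u ++ [true])).map not).reverse m := by
  rw [← dK_nil, dK_x _ _ (by simp), dK_move _ _ (by simp), dK_symm, dK_nil]
  simp

/-! ### Relation with multiple zeta values -/

def dterm (k n : ℕ) : ENNReal := dI n ^ k

lemma dF_replicate (j : ℕ) (l : List Bool) (m : ℕ) :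
    dF (List.replicate j false ++ l) m = dI m ^ j * dF l m := by
  induction j with
  | zero => simp
  | succ j ih => simp only [List.replicate_succ, List.cons_append, dF, ih]; ring

/-- reversed word of an index -/
def dW : (r : ℕ) → (Fin r → ℕ) → List Bool
  | 0, _ => []
  | r + 1, k => List.replicate (k (Fin.last r) - 1) false ++ true :: dW r (fun i => k i.castSucc)

open Classical in
def dG (r : ℕ) (k : Fin r → ℕ) (n : Fin r → ℕ) : ENNReal :=
  if (∀ i, 0 < n i) ∧ StrictMono n then ∏ i, dI (n i) ^ k i else 0

open Classical in
lemma dG_snoc (r : ℕ) (k : Fin (r + 1) → ℕ) (n : Fin r → ℕ) (m : ℕ) :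
    dG (r + 1) k (Fin.snoc n m : Fin (r + 1) → ℕ)
      = (if 0 < m ∧ ∀ i, n i < m then 1 else 0) * dI m ^ k (Fin.last r)
        * dG r (fun i => k i.castSucc) n := by
  have h : ((∀ i, 0 < (Fin.snoc n m : Fin (r + 1) → ℕ) i) ∧
      StrictMono (Fin.snoc n m : Fin (r + 1) → ℕ)) ↔
      (0 < m ∧ ∀ i, n i < m) ∧ ((∀ i, 0 < n i) ∧ StrictMono n) := by
    constructor
    · rintro ⟨h1, h2⟩
      refine ⟨⟨by simpa using h1 (Fin.last r), fun i => ?_⟩, fun i => by simpa using h1 i.castSucc,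
        fun i j hij => ?_⟩
      · simpa using h2 (Fin.castSucc_lt_last i)
      · simpa using h2 (Fin.castSucc_lt_castSucc_iff.2 hij)
    · rintro ⟨⟨h1, h2⟩, h3, h4⟩
      refine ⟨fun i => ?_, fun i j hij => ?_⟩
      · induction i using Fin.lastCases with
        | last => simpa using h1
        | cast i => simpa using h3 i
      · induction j using Fin.lastCases with
        | last =>
          induction i using Fin.lastCases with
          | last => exact absurd hij (lt_irrefl _)
          | cast i => simpa using h2 i
        | cast j =>
          induction i using Fin.lastCases with
          | last => exact absurd hij (not_lt.2 (Fin.le_last _))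
          | cast i => simpa using h4 (Fin.castSucc_lt_castSucc_iff.1 hij)
  unfold dG
  simp only [h, Fin.prod_univ_castSucc, Fin.snoc_castSucc, Fin.snoc_last]
  by_cases c1 : (0 < m ∧ ∀ i, n i < m) <;> by_cases c2 : ((∀ i, 0 < n i) ∧ StrictMono n)
  · rw [if_pos ⟨c1, c2⟩, if_pos c1, if_pos c2]; ring
  · rw [if_neg (fun h => c2 h.2), if_neg c2]; ring
  · rw [if_neg (fun h => c1 h.1), if_neg c1]; ring
  · rw [if_neg (fun h => c1 h.1), if_neg c1]; ring

lemma tsum_snoc (r : ℕ) (g : (Fin (r + 1) → ℕ) → ENNReal) :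
    ∑' n, g n = ∑' m : ℕ, ∑' n : Fin r → ℕ, g (Fin.snoc n m : Fin (r + 1) → ℕ) := by
  rw [← ENNReal.tsum_prod (f := fun m n => g (Fin.snoc n m : Fin (r + 1) → ℕ)),
    ← (Fin.snocEquiv (fun _ : Fin (r + 1) => ℕ)).tsum_eq]
  rfl

open Classical in
lemma dF_step (r : ℕ) (k : Fin (r + 1) → ℕ) (hk : ∀ i, 1 ≤ k i) (m : ℕ)
    (ih : 0 < m → ∑' n, (if ∀ i, n i < m then 1 else 0) * dG r (fun i => k i.castSucc) n
      = ∑' a, dL a m * dF (dW r (fun i => k i.castSucc)) a) :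
    ∑' n : Fin r → ℕ, dG (r + 1) k (Fin.snoc n m : Fin (r + 1) → ℕ) = dF (dW (r + 1) k) m := by
  obtain ⟨j, hj⟩ : ∃ j, k (Fin.last r) = j + 1 := ⟨k (Fin.last r) - 1, by have := hk (Fin.last r); omega⟩
  simp only [dW, dF_replicate, dG_snoc]
  rcases Nat.eq_zero_or_pos m with rfl | hm
  · simp [dF, dI_zero]
  · simp only [hm, true_and, dF]
    have := ih hm
    calc _ = dI m ^ k (Fin.last r) *
          ∑' n, (if ∀ i, n i < m then 1 else 0) * dG r (fun i => k i.castSucc) n := by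
            rw [← ENNReal.tsum_mul_left]
            refine tsum_congr fun n => ?_
            ring
      _ = _ := by
            rw [this, hj, Nat.add_sub_cancel, ← ENNReal.tsum_mul_left, ← ENNReal.tsum_mul_left]
            refine tsum_congr fun n => ?_
            ring

open Classical in
lemma dF_trunc (r : ℕ) : ∀ (k : Fin r → ℕ), (∀ i, 1 ≤ k i) → ∀ m, 0 < m →
    ∑' n, (if ∀ i, n i < m then 1 else 0) * dG r k n = ∑' a, dL a m * dF (dW r k) a := by
  induction r with
  | zero =>
    intro k _ m hm
    rw [tsum_eq_single 0 (f := fun a => dL a m * dF (dW 0 k) a)]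
    · rw [tsum_fintype]
      simp [dW, dF, dL, hm, dG, Subsingleton.strictMono]
    · intro a ha; simp [dW, dF, ha]
  | succ r ih =>
    intro k hk M hM
    rw [tsum_snoc]
    refine tsum_congr fun m => ?_
    rw [← dF_step r k hk m (fun hm => ih _ (fun i => hk _) m hm), ← ENNReal.tsum_mul_left]
    refine tsum_congr fun n => ?_
    rw [dG_snoc]
    by_cases c : 0 < m ∧ ∀ i, n i < m
    · have : (∀ i, (Fin.snoc n m : Fin (r + 1) → ℕ) i < M) ↔ m < M := by
        constructor
        · intro h; simpa using h (Fin.last r)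
        · intro h i
          induction i using Fin.lastCases with
          | last => simpa using h
          | cast i => simpa using (c.2 i).trans h
      simp only [this, dL]
    · simp [c]

lemma MZV_eq (r : ℕ) (k : Fin (r + 1) → ℕ) (hk : ∀ i, 1 ≤ k i) :
    MZV (r + 1) k = (∑' m, dF (dW (r + 1) k) m).toReal := by
  classical
  have h1 : ∑' m, dF (dW (r + 1) k) m = ∑' n, dG (r + 1) k n := by
    rw [tsum_snoc]
    refine tsum_congr fun m => ?_
    rw [dF_step r k hk m (fun hm => dF_trunc r _ (fun i => hk _) m hm)]
  have h2 : ∑' n, dG (r + 1) k n = ∑' n : {n : Fin (r + 1) → ℕ // (∀ i, 0 < n i) ∧ StrictMono n},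
      ∏ i, dI (n.1 i) ^ k i := by
    have := tsum_subtype {n : Fin (r + 1) → ℕ | (∀ i, 0 < n i) ∧ StrictMono n}
      (fun n => ∏ i, dI (n i) ^ k i)
    refine Eq.trans ?_ this.symm
    refine tsum_congr fun n => ?_
    simp only [dG, Set.indicator, Set.mem_ofPred_eq]
  rw [h1, h2, ENNReal.tsum_toReal_eq]
  · unfold MZV
    refine tsum_congr fun n => ?_
    rw [ENNReal.toReal_prod]
    refine Finset.prod_congr rfl fun i _ => ?_
    rw [ENNReal.toReal_pow, dI, ENNReal.toReal_ofReal (by positivity), one_div_pow]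
  · intro n
    exact ENNReal.prod_ne_top fun i _ => ENNReal.pow_ne_top ENNReal.ofReal_ne_top

/-! ### Words -/

def mon (l : List Bool) : H := (l.map (FreeAlgebra.ι ℚ)).prod

lemma mon_append (a b : List Bool) : mon (a ++ b) = mon a * mon b := by simp [mon]

lemma mon_dW (r : ℕ) (k : Fin r → ℕ) :
    (List.ofFn fun i => Hy * Hx ^ (k i - 1)).prod = mon (dW r k).reverse := by
  induction r with
  | zero => simp [mon, dW]
  | succ r ih =>
    rw [List.ofFn_succ', List.concat_eq_append, List.prod_append, ih]
    simp [dW, mon, Hx, Hy]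

lemma exists_dW (l : List Bool) : ∃ (r : ℕ) (k : Fin (r + 1) → ℕ),
    (∀ i, 1 ≤ k i) ∧ dW (r + 1) k = l ++ [true] := by
  induction l with
  | nil => exact ⟨0, fun _ => 1, fun _ => le_rfl, by simp [dW]⟩
  | cons c l ih =>
    obtain ⟨r, k, hk, h⟩ := ih
    cases c with
    | true =>
      refine ⟨r + 1, Fin.snoc k 1, fun i => ?_, ?_⟩
      · induction i using Fin.lastCases with
        | last => simp
        | cast i => simpa using hk i
      · rw [dW]
        simp [h]
    | false =>
      refine ⟨r, Function.update k (Fin.last r) (k (Fin.last r) + 1), fun i => ?_, ?_⟩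
      · by_cases hi : i = Fin.last r
        · subst hi; simp
        · simpa [hi] using hk i
      · have hl := hk (Fin.last r)
        rw [List.cons_append, ← h]
        simp only [dW, Function.update_self]
        rw [show k (Fin.last r) + 1 - 1 = (k (Fin.last r) - 1) + 1 by omega,
          List.replicate_succ, List.cons_append]
        congr 4
        funext i
        rw [Function.update_of_ne (Fin.castSucc_lt_last i).ne]

lemma Z_mon (Z : H →ₗ[ℚ] ℝ) (hZ : IsZetaMap Z) (u : List Bool) :
    Z (mon (false :: (u ++ [true])).reverse)
      = (∑' m, dF (false :: (u ++ [true])) m).toReal := by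
  obtain ⟨r, k, hk, h⟩ := exists_dW (false :: u)
  rw [← List.cons_append, ← h, ← mon_dW, ← MZV_eq r k hk]
  apply hZ r k hk
  by_contra hlt
  have : k (Fin.last r) - 1 = 0 := by omega
  simp [dW, this] at h

lemma tau_mon (t : H →ₗ[ℚ] H) (ht : IsTau t) (l : List Bool) :
    t (mon l) = mon (l.map not).reverse := by
  obtain ⟨h1, h2, h3, h4⟩ := ht
  induction l with
  | nil => simpa [mon] using h1
  | cons c l ih =>
    have : mon (c :: l) = mon [c] * mon l := by simp [mon]
    rw [this, h2, ih, List.map_cons, List.reverse_cons, mon_append]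
    congr 1
    cases c
    · simpa [mon, Hx, Hy] using h3
    · simpa [mon, Hx, Hy] using h4

lemma mon_span (w : H) : w ∈ Submodule.span ℚ (Set.range mon) := by
  induction w using FreeAlgebra.induction with
  | grade0 q =>
    rw [Algebra.algebraMap_eq_smul_one]
    exact Submodule.smul_mem _ _ (Submodule.subset_span ⟨[], by simp [mon]⟩)
  | grade1 c => exact Submodule.subset_span ⟨[c], by simp [mon]⟩
  | mul a b ha hb =>
    have := Submodule.mul_mem_mul ha hb
    rw [Submodule.span_mul_span] at this
    refine Submodule.span_mono ?_ this
    rintro _ ⟨_, ⟨l, rfl⟩, _, ⟨l', rfl⟩, rfl⟩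
    exact ⟨l ++ l', mon_append _ _⟩
  | add a b ha hb => exact Submodule.add_mem _ ha hb

lemma duality (Z : H →ₗ[ℚ] ℝ) (hZ : IsZetaMap Z) (t : H →ₗ[ℚ] H) (ht : IsTau t) (w : H) :
    Z (Hy * w * Hx) = Z (t (Hy * w * Hx)) := by
  induction mon_span w using Submodule.span_induction with
  | mem w hw =>
    obtain ⟨l, rfl⟩ := hw
    have e : Hy * mon l * Hx = mon (false :: (l.reverse ++ [true])).reverse := by
      simp [mon, Hx, Hy, mul_assoc]
    have e2 : (((false :: (l.reverse ++ [true])).reverse.map not).reverse)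
        = (false :: ((l.map not) ++ [true])).reverse := by
      simp
    rw [e, tau_mon t ht, Z_mon Z hZ, dF_duality, e2, Z_mon Z hZ]
    simp
  | zero => simp
  | add a b _ _ ha hb => simp only [mul_add, add_mul, map_add, ha, hb]
  | smul q a _ ha => simp only [mul_smul_comm, smul_mul_assoc, map_smul, ha]

/-- Duality. For every `A ∈ yℌ`, `B ∈ ℌx` and every `s ≥ 0`,
`Z(A (x+y)^s B) = Z(τ(B) (x+y)^s τ(A))`; equivalently `f(A,B) = f(τ(B), τ(A))`. -/
theorem statement15 (Z : H →ₗ[ℚ] ℝ) (hZ : IsZetaMap Z)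
    (t : H →ₗ[ℚ] H) (ht : IsTau t)
    (A B : H) (hA : ∃ w, A = Hy * w) (hB : ∃ w, B = w * Hx) (s : ℕ) :
    Z (A * (Hx + Hy) ^ s * B) = Z (t B * (Hx + Hy) ^ s * t A) := by
  obtain ⟨a, rfl⟩ := hA
  obtain ⟨b, rfl⟩ := hB
  have hp : ∀ s : ℕ, t ((Hx + Hy) ^ s) = (Hx + Hy) ^ s := by
    intro s
    induction s with
    | zero => simpa using ht.1
    | succ s ih => rw [pow_succ, ht.2.1, ih, map_add, ht.2.2.1, ht.2.2.2, add_comm Hy Hx, ← pow_succ', pow_succ]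
  have e : t (b * Hx) * (Hx + Hy) ^ s * t (Hy * a) = t (Hy * a * (Hx + Hy) ^ s * (b * Hx)) := by
    rw [ht.2.1 (Hy * a * (Hx + Hy) ^ s), ht.2.1 (Hy * a), hp, mul_assoc]
  rw [e]
  have := duality Z hZ t ht (a * (Hx + Hy) ^ s * b)
  simpa only [mul_assoc] using this

end
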